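/- arXiv:1110.2706 — 2 statements merged into one kernel-verified Lean document; each statement's English description precedes it below -/
import Mathlib

section
/- Every minimal second syzygy of W_{p−1,p−1} is isomorphic, as an A-module, to W_{2p−1,p}. -/
open MvPolynomial Module

set_option maxHeartbeats 1000000
set_option synthInstance.maxHeartbeats 400000

noncomputable section

/-- The defining ideal `(X^p, Y^p)` of the polynomial ring in two variables. -/
def relI (k : Type) [Field k] (p : ℕ) : Ideal (MvPolynomial (Fin 2) k) :=
  Ideal.span {(X 0 : MvPolynomial (Fin 2) k) ^ p, (X 1 : MvPolynomial (Fin 2) k) ^ p}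

/-- The algebra `A = k[X,Y]/(X^p, Y^p)`. -/
abbrev Amod (k : Type) [Field k] (p : ℕ) : Type :=
  MvPolynomial (Fin 2) k ⧸ relI k p

variable (k : Type) [Field k] (p : ℕ)

/-- `x`, the image of `X` in `A`. -/
def xA : Amod k p := Ideal.Quotient.mk (relI k p) (X 0)

/-- `y`, the image of `Y` in `A`. -/
def yA : Amod k p := Ideal.Quotient.mk (relI k p) (X 1)

/-- The maximal ideal `𝔪 = (x, y)` of `A`. -/
def mA : Ideal (Amod k p) := Ideal.span {xA k p, yA k p}

/-- A point operator: `u = α x + β y` with `(α, β) ≠ (0, 0)`. -/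
def IsPointOp (u : Amod k p) : Prop :=
  ∃ α β : k, (α ≠ 0 ∨ β ≠ 0) ∧ u = α • xA k p + β • yA k p

/-- Equal images property: `u M = 𝔪 M` for every point operator `u`. -/
def EIP (M : Type) [AddCommGroup M] [Module (Amod k p) M] : Prop :=
  ∀ u : Amod k p, IsPointOp k p u →
    LinearMap.range (LinearMap.lsmul (Amod k p) M u)
      = mA k p • (⊤ : Submodule (Amod k p) M)

/-- `M` lies in `EIP_d`: equal images property and `𝔪^d M = 0`. -/
def EIPd (d : ℕ) (M : Type) [AddCommGroup M] [Module (Amod k p) M] : Prop :=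
  EIP k p M ∧ (mA k p) ^ d • (⊤ : Submodule (Amod k p) M) = ⊥


/-- The standard basis vector `v_i` of the free module `A^n`. -/
def stdV (n : ℕ) (i : Fin n) : Fin n → Amod k p := Pi.single i 1

/-- The set of defining relations of the module `W_{n,d}` inside the free module `A^n`
(indices of `v_1, …, v_n` are `0, …, n-1`): `x·v_1`, `y·v_n`, `x^d·v_i` for `2 ≤ i ≤ n`,
and `y·v_i − x·v_{i+1}` for `1 ≤ i ≤ n−1`. -/
def NSet (n d : ℕ) : Set (Fin n → Amod k p) :=
  (⋃ (i : Fin n) (_ : i.val = 0), {xA k p • stdV k p n i}) ∪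
  (⋃ (i : Fin n) (_ : i.val = n - 1), {yA k p • stdV k p n i}) ∪
  (⋃ (i : Fin n) (_ : i.val ≠ 0), {(xA k p) ^ d • stdV k p n i}) ∪
  (⋃ (i : Fin n) (j : Fin n) (_ : j.val = i.val + 1),
    {yA k p • stdV k p n i - xA k p • stdV k p n j})

/-- The submodule `N_{n,d} ⊆ A^n` of defining relations of `W_{n,d}`. -/
def NSub (n d : ℕ) : Submodule (Amod k p) (Fin n → Amod k p) :=
  Submodule.span (Amod k p) (NSet k p n d)

/-- The module `W_{n,d} = A^n / N_{n,d}`. -/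
abbrev Wmod (n d : ℕ) : Type := (Fin n → Amod k p) ⧸ NSub k p n d

/-- `IsMinSyz m N M`: the `A`-module `N` is a minimal `m`-th syzygy of `M`, i.e. it arises
(up to isomorphism) as the last kernel `ker(F_{m−1} → F_{m−2})` of an exact sequence
`F_{m−1} → ⋯ → F_1 → F_0 → M → 0` of finitely generated free `A`-modules `F_i` with
`ker(F_0 → M) ⊆ 𝔪F_0` and `ker(F_i → F_{i−1}) ⊆ 𝔪F_i`; equivalently, it is obtained by
`m`-fold iteration of minimal first syzygies. -/
def IsMinSyz : ℕ → ModuleCat.{0} (Amod k p) → ModuleCat.{0} (Amod k p) → Prop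
  | 0, N, M => Nonempty ((↥N) ≃ₗ[Amod k p] (↥M))
  | (m + 1), N, M => ∃ (r : ℕ) (g : (Fin r → Amod k p) →ₗ[Amod k p] M),
      Function.Surjective g ∧
      LinearMap.ker g ≤ mA k p • (⊤ : Submodule (Amod k p) (Fin r → Amod k p)) ∧
      IsMinSyz m N (ModuleCat.of (Amod k p) (↥(LinearMap.ker g)))

section Aux

open Finset

/-- exponent vector of `X^s Y^t`. -/
def expV (s t : ℕ) : Fin 2 →₀ ℕ := Finsupp.single 0 s + Finsupp.single 1 t

lemma monomial_expV (s t : ℕ) :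
    (monomial (expV s t) (1 : k)) = X 0 ^ s * X 1 ^ t := by
  rw [X_pow_eq_monomial, X_pow_eq_monomial, monomial_mul, one_mul, expV]

lemma expV_zero (s t : ℕ) : expV s t 0 = s := by simp [expV]

lemma expV_one (s t : ℕ) : expV s t 1 = t := by simp [expV]

lemma expV_eta (m : Fin 2 →₀ ℕ) : expV (m 0) (m 1) = m := by
  ext i
  fin_cases i
  · simp [expV]
  · simp [expV]

lemma expV_inj {s t s' t' : ℕ} : expV s t = expV s' t' ↔ s = s' ∧ t = t' := by
  constructor
  · intro h
    constructor
    · rw [← expV_zero s t, h, expV_zero]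
    · rw [← expV_one s t, h, expV_one]
  · rintro ⟨rfl, rfl⟩
    rfl

/-- coefficient functional on polynomials. -/
def pcoef (s t : ℕ) : MvPolynomial (Fin 2) k →ₗ[k] k :=
  if s < p ∧ t < p then lcoeff k (expV s t) else 0

lemma pcoef_relI (s t : ℕ) (f : MvPolynomial (Fin 2) k) (hf : f ∈ relI k p) :
    pcoef k p s t f = 0 := by
  unfold pcoef
  split_ifs with h
  · rw [relI, Ideal.mem_span_pair] at hf
    obtain ⟨a, b, rfl⟩ := hf
    simp only [lcoeff_apply, coeff_add]
    rw [X_pow_eq_monomial, X_pow_eq_monomial, coeff_mul_monomial', coeff_mul_monomial']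
    rw [if_neg, if_neg, add_zero]
    · intro hh
      have := hh 1
      simp [expV_one] at this
      omega
    · intro hh
      have := hh 0
      simp [expV_zero] at this
      omega
  · rfl

/-- coefficient functional on `A`. -/
def coef (s t : ℕ) : Amod k p →ₗ[k] k :=
  (Submodule.liftQ ((relI k p).restrictScalars k) (pcoef k p s t)
    (fun f hf => pcoef_relI k p s t f hf)) ∘ₗ
  (Submodule.Quotient.restrictScalarsEquiv k (relI k p)).symm.toLinearMap

lemma coef_mk (s t : ℕ) (f : MvPolynomial (Fin 2) k) :
    coef k p s t (Ideal.Quotient.mk (relI k p) f) = pcoef k p s t f := rfl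

lemma x_pow : (xA k p) ^ p = 0 := by
  rw [xA, ← map_pow, Ideal.Quotient.eq_zero_iff_mem]
  exact Ideal.subset_span (by simp)

lemma y_pow : (yA k p) ^ p = 0 := by
  rw [yA, ← map_pow, Ideal.Quotient.eq_zero_iff_mem]
  exact Ideal.subset_span (by simp)

lemma x_pow_ge {e : ℕ} (h : p ≤ e) : (xA k p) ^ e = 0 := pow_eq_zero_of_le h (x_pow k p)

lemma y_pow_ge {e : ℕ} (h : p ≤ e) : (yA k p) ^ e = 0 := pow_eq_zero_of_le h (y_pow k p)

lemma coef_monom (m n s t : ℕ) :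
    coef k p s t (xA k p ^ m * yA k p ^ n)
      = if s = m ∧ t = n ∧ s < p ∧ t < p then 1 else 0 := by
  rw [xA, yA, ← map_pow, ← map_pow, ← map_mul, coef_mk, ← monomial_expV, pcoef]
  split_ifs with h1 h2 h2
  · rw [lcoeff_apply, coeff_monomial, if_pos]
    rw [expV_inj]
    omega
  · rw [lcoeff_apply, coeff_monomial, if_neg]
    rw [expV_inj]
    omega
  · omega
  · rfl

lemma span_monom : Submodule.span k
    (Set.range fun q : ℕ × ℕ => xA k p ^ q.1 * yA k p ^ q.2) = ⊤ := by
  rw [eq_top_iff]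
  rintro a -
  obtain ⟨f, rfl⟩ := Ideal.Quotient.mk_surjective a
  induction f using MvPolynomial.induction_on' with
  | monomial u c =>
    have : (monomial u c : MvPolynomial (Fin 2) k) = c • (X 0 ^ (u 0) * X 1 ^ (u 1)) := by
      rw [← monomial_expV, expV_eta, smul_monomial, smul_eq_mul, mul_one]
    rw [this]
    have h2 : Ideal.Quotient.mk (relI k p) (c • (X 0 ^ (u 0) * X 1 ^ (u 1)))
      = c • (xA k p ^ (u 0) * yA k p ^ (u 1)) := by
      rw [xA, yA, ← map_pow, ← map_pow, ← map_mul]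
      rfl
    rw [h2]
    exact Submodule.smul_mem _ _ (Submodule.subset_span ⟨(u 0, u 1), rfl⟩)
  | add f g hf hg =>
    rw [map_add]
    exact Submodule.add_mem _ hf hg

lemma linext {M : Type*} [AddCommGroup M] [Module k M] {f g : Amod k p →ₗ[k] M}
    (h : ∀ m n, f (xA k p ^ m * yA k p ^ n) = g (xA k p ^ m * yA k p ^ n)) : f = g := by
  apply LinearMap.ext_on_range (span_monom k p)
  rintro ⟨m, n⟩
  exact h m n

/-- multiplication as a `k`-linear map. -/
lemma coef_x_succ (s t : ℕ) (hs : s + 1 < p) (a : Amod k p) :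
    coef k p (s + 1) t (xA k p * a) = coef k p s t a := by
  have : (coef k p (s + 1) t) ∘ₗ (LinearMap.mulLeft k (xA k p)) = coef k p s t := by
    apply linext
    intro m n
    simp only [LinearMap.comp_apply, LinearMap.mulLeft_apply]
    rw [← mul_assoc, ← pow_succ', coef_monom, coef_monom]
    apply if_congr _ rfl rfl
    omega
  exact LinearMap.congr_fun this a

lemma coef_x_zero (t : ℕ) (a : Amod k p) :
    coef k p 0 t (xA k p * a) = 0 := by
  have : (coef k p 0 t) ∘ₗ (LinearMap.mulLeft k (xA k p)) = 0 := by
    apply linext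
    intro m n
    simp only [LinearMap.comp_apply, LinearMap.mulLeft_apply]
    rw [← mul_assoc, ← pow_succ', coef_monom, if_neg (by omega)]
    rfl
  exact LinearMap.congr_fun this a

lemma coef_y_succ (s t : ℕ) (hs : t + 1 < p) (a : Amod k p) :
    coef k p s (t + 1) (yA k p * a) = coef k p s t a := by
  have : (coef k p s (t + 1)) ∘ₗ (LinearMap.mulLeft k (yA k p)) = coef k p s t := by
    apply linext
    intro m n
    simp only [LinearMap.comp_apply, LinearMap.mulLeft_apply]
    rw [mul_left_comm, ← pow_succ', coef_monom, coef_monom]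
    apply if_congr _ rfl rfl
    omega
  exact LinearMap.congr_fun this a

lemma coef_y_zero (s : ℕ) (a : Amod k p) :
    coef k p s 0 (yA k p * a) = 0 := by
  have : (coef k p s 0) ∘ₗ (LinearMap.mulLeft k (yA k p)) = 0 := by
    apply linext
    intro m n
    simp only [LinearMap.comp_apply, LinearMap.mulLeft_apply]
    rw [mul_left_comm, ← pow_succ', coef_monom, if_neg (by omega)]
    rfl
  exact LinearMap.congr_fun this a

lemma coef_ext (a : Amod k p) (h : ∀ s t, s < p → t < p → coef k p s t a = 0) : a = 0 := by
  have : (∑ q ∈ range p ×ˢ range p,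
      (LinearMap.toSpanSingleton k (Amod k p) (xA k p ^ q.1 * yA k p ^ q.2)) ∘ₗ
        coef k p q.1 q.2) = LinearMap.id := by
    apply linext
    intro m n
    simp only [LinearMap.sum_apply, LinearMap.comp_apply, LinearMap.toSpanSingleton_apply,
      coef_monom, LinearMap.id_apply]
    by_cases hmn : m < p ∧ n < p
    · rw [Finset.sum_eq_single (m, n)]
      · rw [if_pos (by simp [hmn]), one_smul]
      · rintro ⟨s, t⟩ - hne
        rw [if_neg, zero_smul]
        rintro ⟨h1, h2, -⟩
        exact hne (by simp_all)
      · intro hh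
        simp [hmn] at hh
    · rw [Finset.sum_eq_zero]
      · rw [not_and_or] at hmn
        rcases hmn with h' | h'
        · rw [x_pow_ge k p (by omega), zero_mul]
        · rw [y_pow_ge k p (by omega), mul_zero]
      · rintro ⟨s, t⟩ -
        rw [if_neg (by omega), zero_smul]
  have h2 := LinearMap.congr_fun this a
  rw [LinearMap.id_apply] at h2
  rw [← h2]
  simp only [LinearMap.sum_apply, LinearMap.comp_apply, LinearMap.toSpanSingleton_apply]
  apply Finset.sum_eq_zero
  rintro ⟨s, t⟩ hst
  simp only [Finset.mem_product, Finset.mem_range] at hst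
  rw [h s t hst.1 hst.2, zero_smul]

/-! ### uniqueness of minimal covers -/

lemma mA_le_jac : mA k p ≤ Ideal.jacobson ⊥ := by
  refine le_trans ?_ (Ideal.radical_le_jacobson (I := ⊥))
  rw [mA, Ideal.span_le]
  intro a ha
  simp only [Set.mem_insert_iff, Set.mem_singleton_iff] at ha
  rcases ha with rfl | rfl
  · exact ⟨p, by simp [x_pow]⟩
  · exact ⟨p, by simp [y_pow]⟩

lemma cover_lift_surj {r s : ℕ} {M : Type*} [AddCommGroup M] [Module (Amod k p) M]
    (g : (Fin r → Amod k p) →ₗ[Amod k p] M) (hg : Function.Surjective g)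
    (g' : (Fin s → Amod k p) →ₗ[Amod k p] M) 
    (hk' : LinearMap.ker g' ≤ mA k p • (⊤ : Submodule (Amod k p) (Fin s → Amod k p)))
    (h : (Fin r → Amod k p) →ₗ[Amod k p] (Fin s → Amod k p)) (hh : g' ∘ₗ h = g) :
    Function.Surjective h := by
  rw [← LinearMap.range_eq_top, eq_top_iff]
  apply Submodule.le_of_le_smul_of_le_jacobson_bot (I := mA k p) Module.Finite.fg_top
    (mA_le_jac k p)
  rintro b -
  obtain ⟨a, ha⟩ := hg (g' b)
  have : b = h a + (b - h a) := by abel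
  rw [this]
  refine Submodule.add_mem_sup (LinearMap.mem_range_self h a) ?_
  apply hk'
  rw [LinearMap.mem_ker, map_sub, ← ha, ← hh]
  simp

lemma cover_unique {r s : ℕ} {M M' : Type*} [AddCommGroup M] [Module (Amod k p) M]
    [AddCommGroup M'] [Module (Amod k p) M'] (φ : M ≃ₗ[Amod k p] M')
    (g : (Fin r → Amod k p) →ₗ[Amod k p] M) (hg : Function.Surjective g)
    (hk : LinearMap.ker g ≤ mA k p • (⊤ : Submodule (Amod k p) (Fin r → Amod k p)))
    (g' : (Fin s → Amod k p) →ₗ[Amod k p] M') (hg' : Function.Surjective g')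
    (hk' : LinearMap.ker g' ≤ mA k p • (⊤ : Submodule (Amod k p) (Fin s → Amod k p))) :
    Nonempty (LinearMap.ker g ≃ₗ[Amod k p] LinearMap.ker g') := by
  set g₁ : (Fin r → Amod k p) →ₗ[Amod k p] M' := φ.toLinearMap ∘ₗ g with hg₁
  have hs₁ : Function.Surjective g₁ := φ.surjective.comp hg
  have hker : LinearMap.ker g₁ = LinearMap.ker g := by
    rw [hg₁, LinearEquiv.ker_comp]
  have hk₁ := hker.le.trans hk
  obtain ⟨h, hh⟩ := Module.projective_lifting_property g' g₁ hg'
  obtain ⟨h', hh'⟩ := Module.projective_lifting_property g₁ g' hs₁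
  have hsurj := cover_lift_surj k p g₁ hs₁ g' hk' h hh
  have hsurj' := cover_lift_surj k p g' hg' g₁ hk₁ h' hh'
  have hinj : Function.Injective (h' ∘ₗ h) :=
    OrzechProperty.injective_of_surjective_endomorphism _ (hsurj'.comp hsurj)
  have hinjh : Function.Injective h := by
    rw [LinearMap.coe_comp] at hinj
    exact hinj.of_comp
  let H := LinearEquiv.ofBijective h ⟨hinjh, hsurj⟩
  have hm : (LinearMap.ker g).map (H : (Fin r → Amod k p) →ₗ[Amod k p] (Fin s → Amod k p))
      = LinearMap.ker g' := by
    rw [← hker, ← hh, LinearMap.ker_comp]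
    exact Submodule.map_comap_eq_of_surjective hsurj _
  exact ⟨(H.submoduleMap _).trans (LinearEquiv.ofEq _ _ hm)⟩

/-! ### relations in `W` -/

lemma vmul_smul {n : ℕ} (a b : Amod k p) (v : Fin n → Amod k p) :
    (a * b) • v = a • b • v := mul_smul a b v

lemma vzero_smul {n : ℕ} (v : Fin n → Amod k p) :
    (0 : Amod k p) • v = 0 := by
  funext i
  exact zero_mul (v i)

lemma vsum {n : ℕ} (f : Fin n → Amod k p) : f = ∑ j, f j • stdV k p n j := by
  conv_lhs => rw [← (Pi.basisFun (Amod k p) (Fin n)).sum_repr f]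
  simp [stdV]

lemma rel_first {n d : ℕ} (i : Fin n) (hi : i.val = 0) :
    xA k p • stdV k p n i ∈ NSub k p n d := by
  apply Submodule.subset_span
  refine Or.inl (Or.inl (Or.inl ?_))
  simp only [Set.mem_iUnion, Set.mem_singleton_iff]
  exact ⟨i, hi, rfl⟩

lemma rel_last {n d : ℕ} (i : Fin n) (hi : i.val = n - 1) :
    yA k p • stdV k p n i ∈ NSub k p n d := by
  apply Submodule.subset_span
  refine Or.inl (Or.inl (Or.inr ?_))
  simp only [Set.mem_iUnion, Set.mem_singleton_iff]
  exact ⟨i, hi, rfl⟩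

lemma rel_step {n d : ℕ} (i j : Fin n) (hj : j.val = i.val + 1) :
    yA k p • stdV k p n i - xA k p • stdV k p n j ∈ NSub k p n d := by
  apply Submodule.subset_span
  refine Or.inr ?_
  simp only [Set.mem_iUnion, Set.mem_singleton_iff]
  exact ⟨i, j, hj, rfl⟩

lemma NSub_le {n d : ℕ} (Q : Submodule (Amod k p) (Fin n → Amod k p))
    (h1 : ∀ i : Fin n, i.val = 0 → xA k p • stdV k p n i ∈ Q)
    (h2 : ∀ i : Fin n, i.val = n - 1 → yA k p • stdV k p n i ∈ Q)
    (h3 : ∀ i : Fin n, i.val ≠ 0 → xA k p ^ d • stdV k p n i ∈ Q)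
    (h4 : ∀ i j : Fin n, j.val = i.val + 1 →
      yA k p • stdV k p n i - xA k p • stdV k p n j ∈ Q) : NSub k p n d ≤ Q := by
  rw [NSub, Submodule.span_le]
  intro v hv
  simp only [NSet, Set.mem_union, Set.mem_iUnion, Set.mem_singleton_iff] at hv
  rcases hv with ((⟨i, hi, rfl⟩ | ⟨i, hi, rfl⟩) | ⟨i, hi, rfl⟩) | ⟨i, j, hj, rfl⟩
  · exact h1 i hi
  · exact h2 i hi
  · exact h3 i hi
  · exact h4 i j hj

/-- `x^(i+1) v_i` follows from the step relations. -/
lemma x_pow_mem {n : ℕ} (Q : Submodule (Amod k p) (Fin n → Amod k p))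
    (h1 : ∀ i : Fin n, i.val = 0 → xA k p • stdV k p n i ∈ Q)
    (h4 : ∀ i j : Fin n, j.val = i.val + 1 →
      yA k p • stdV k p n i - xA k p • stdV k p n j ∈ Q) (i : ℕ) :
    ∀ (hi : i < n) (e : ℕ), i < e → xA k p ^ e • stdV k p n ⟨i, hi⟩ ∈ Q := by
  induction i with
  | zero =>
    intro hi e he
    obtain ⟨e, rfl⟩ : ∃ e', e = e' + 1 := ⟨e - 1, by omega⟩
    rw [pow_succ, vmul_smul]
    exact Q.smul_mem _ (h1 _ rfl)
  | succ i ih =>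
    intro hi e he
    obtain ⟨e, rfl⟩ : ∃ e', e = e' + 1 := ⟨e - 1, by omega⟩
    have a1 := Q.smul_mem (yA k p) (ih (by omega) e (by omega))
    have a2 := Q.smul_mem (xA k p ^ e) (h4 ⟨i, by omega⟩ ⟨i + 1, hi⟩ rfl)
    have a3 := Q.sub_mem a1 a2
    rw [smul_sub, smul_smul, smul_smul, smul_smul, mul_comm (yA k p), sub_sub_cancel,
      ← pow_succ] at a3
    exact a3

lemma smul_mem_m {n : ℕ} {a : Amod k p} (ha : a ∈ mA k p) (v : Fin n → Amod k p) :
    a • v ∈ mA k p • (⊤ : Submodule (Amod k p) (Fin n → Amod k p)) :=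
  Submodule.smul_mem_smul ha trivial

lemma x_mem : xA k p ∈ mA k p := Ideal.subset_span (by simp)

lemma y_mem : yA k p ∈ mA k p := Ideal.subset_span (by simp)

lemma NSub_le_m {n d : ℕ} (hd : d ≠ 0) :
    NSub k p n d ≤ mA k p • (⊤ : Submodule (Amod k p) (Fin n → Amod k p)) := by
  apply NSub_le
  · intro i _
    exact smul_mem_m k p (x_mem k p) _
  · intro i _
    exact smul_mem_m k p (y_mem k p) _
  · intro i _
    exact smul_mem_m k p (Ideal.pow_mem_of_mem _ (x_mem k p) d (by omega)) _
  · intro i j _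
    exact Submodule.sub_mem _ (smul_mem_m k p (y_mem k p) _) (smul_mem_m k p (x_mem k p) _)

/-! ### the second map of the resolution -/

/-- `(G a)_i = y a_{i+1} - x a_i`. -/
def Gmap : (Fin p → Amod k p) →ₗ[Amod k p] (Fin (p - 1) → Amod k p) :=
  LinearMap.pi fun i =>
    yA k p • LinearMap.proj (⟨i.val + 1, by omega⟩ : Fin p) -
    xA k p • LinearMap.proj (⟨i.val, by omega⟩ : Fin p)

lemma Gmap_apply (a : Fin p → Amod k p) (i : Fin (p - 1)) :
    Gmap k p a i = yA k p * a ⟨i.val + 1, by omega⟩ - xA k p * a ⟨i.val, by omega⟩ := rfl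

lemma Gmap_first (i : Fin (p - 1)) (hi : i.val = 0) (j : Fin p) (hj : j.val = 0) :
    Gmap k p (Pi.single j 1) = - (xA k p • stdV k p (p - 1) i) := by
  ext l
  rw [Gmap_apply]
  simp only [Pi.single_apply, stdV, Pi.neg_apply, Pi.smul_apply, Fin.ext_iff, smul_eq_mul]
  rw [if_neg (by omega)]
  by_cases h : l.val = 0
  · rw [if_pos (by omega), if_pos (by omega)]; ring
  · rw [if_neg (by omega), if_neg (by omega)]; ring

lemma Gmap_last (i : Fin (p - 1)) (hi : i.val = p - 1 - 1) (j : Fin p) (hj : j.val = p - 1) :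
    Gmap k p (Pi.single j 1) = yA k p • stdV k p (p - 1) i := by
  ext l
  rw [Gmap_apply]
  simp only [Pi.single_apply, stdV, Pi.smul_apply, Fin.ext_iff, smul_eq_mul]
  rw [if_neg (show ¬ (l.val = j.val) by omega)]
  by_cases h : l.val = p - 1 - 1
  · rw [if_pos (by omega), if_pos (by omega)]; ring
  · rw [if_neg (by omega), if_neg (by omega)]; ring

lemma Gmap_mid (i i' : Fin (p - 1)) (hi : i'.val = i.val + 1) (j : Fin p)
    (hj : j.val = i.val + 1) :
    Gmap k p (Pi.single j 1) =
      yA k p • stdV k p (p - 1) i - xA k p • stdV k p (p - 1) i' := by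
  ext l
  rw [Gmap_apply]
  simp only [Pi.single_apply, stdV, Pi.sub_apply, Pi.smul_apply, Fin.ext_iff, smul_eq_mul]
  congr 2
  · exact if_congr (by omega) rfl rfl
  · exact if_congr (by omega) rfl rfl

lemma Gmap_range (hp : 2 ≤ p) : LinearMap.range (Gmap k p) = NSub k p (p - 1) (p - 1) := by
  apply le_antisymm
  · rw [LinearMap.range_eq_map, ← (Pi.basisFun (Amod k p) (Fin p)).span_eq, Submodule.map_span,
      Submodule.span_le]
    rintro _ ⟨_, ⟨j, rfl⟩, rfl⟩
    rw [Pi.basisFun_apply]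
    by_cases h0 : j.val = 0
    · rw [Gmap_first k p ⟨0, by omega⟩ rfl j h0]
      exact Submodule.neg_mem _ (rel_first k p _ rfl)
    by_cases h1 : j.val = p - 1
    · rw [Gmap_last k p ⟨p - 1 - 1, by omega⟩ rfl j h1]
      exact rel_last k p _ rfl
    rw [Gmap_mid k p ⟨j.val - 1, by omega⟩ ⟨j.val, by omega⟩ (by simp only; omega) j
      (by simp only; omega)]
    exact rel_step k p _ _ (by simp only; omega)
  · have h1 : ∀ i : Fin (p - 1), i.val = 0 → xA k p • stdV k p (p - 1) i ∈
        LinearMap.range (Gmap k p) := by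
      intro i hi
      refine ⟨- Pi.single ⟨0, by omega⟩ 1, ?_⟩
      rw [map_neg, Gmap_first k p i hi _ rfl, neg_neg]
    have h4 : ∀ i j : Fin (p - 1), j.val = i.val + 1 →
        yA k p • stdV k p (p - 1) i - xA k p • stdV k p (p - 1) j ∈
          LinearMap.range (Gmap k p) := by
      intro i j hj
      exact ⟨Pi.single ⟨i.val + 1, by omega⟩ 1, Gmap_mid k p i j hj _ rfl⟩
    apply NSub_le _ _ _ h1 _ _ h4
    · intro i hi
      exact ⟨Pi.single ⟨p - 1, by omega⟩ 1, Gmap_last k p i hi _ rfl⟩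
    · intro i _
      exact x_pow_mem k p _ h1 h4 i.val i.2 (p - 1) i.2

/-! ### the kernel of the second map -/

lemma ker_rel {a : Fin p → Amod k p} (ha : Gmap k p a = 0) (i : ℕ) (hi : i + 1 < p) :
    yA k p * a ⟨i + 1, hi⟩ = xA k p * a ⟨i, by omega⟩ := by
  have := congrFun ha ⟨i, by omega⟩
  rw [Gmap_apply] at this
  exact sub_eq_zero.mp this

lemma ker_chain {a : Fin p → Amod k p} (ha : Gmap k p a = 0) (δ : ℕ) :
    ∀ (i s t : ℕ) (hi : i + δ < p) (_ : s + δ < p) (_ : t + δ < p),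
      coef k p s (t + δ) (a ⟨i, by omega⟩) = coef k p (s + δ) t (a ⟨i + δ, hi⟩) := by
  induction δ with
  | zero => intros; rfl
  | succ δ ih =>
    intro i s t hi hs ht
    have h1 := ih i s (t + 1) (by omega) (by omega) (by omega)
    have h2 : coef k p (s + δ) (t + 1) (a ⟨i + δ, by omega⟩)
        = coef k p (s + δ + 1) t (a ⟨i + δ + 1, hi⟩) := by
      rw [← coef_x_succ k p (s + δ) (t + 1) (by omega), ← ker_rel k p ha,
        coef_y_succ k p _ _ (by omega)]
    rw [show t + (δ + 1) = t + 1 + δ by omega, h1, h2]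
    rfl

lemma ker_vanish {a : Fin p → Amod k p} (ha : Gmap k p a = 0) (i s t : ℕ) (hi : i < p)
    (hst : s + t < p - 1) : coef k p s t (a ⟨i, hi⟩) = 0 := by
  by_cases h : i + t + 1 ≤ p - 1
  · have h1 := ker_chain k p ha t i s 0 (by omega) (by omega) (by omega)
    rw [zero_add] at h1
    rw [h1, ← coef_x_succ k p (s + t) 0 (by omega), ← ker_rel k p ha _ (by omega), coef_y_zero]
  · have h1 := ker_chain k p ha s (i - s) 0 t (by omega) (by omega) (by omega)
    simp only [zero_add, show i - s + s = i by omega] at h1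
    rw [← h1, ← coef_y_succ k p 0 (t + s) (by omega)]
    obtain ⟨l, hl⟩ : ∃ l, i - s = l + 1 := ⟨i - s - 1, by omega⟩
    simp only [hl]
    rw [ker_rel k p ha l (by omega), coef_x_zero]

/-- entries of the matrix of `U`. -/
def Umat : Matrix (Fin p) (Fin (2 * p - 1)) (Amod k p) := fun i j =>
  if i.val ≤ j.val ∧ j.val ≤ i.val + (p - 1) then
    xA k p ^ (i.val + (p - 1) - j.val) * yA k p ^ (j.val - i.val) else 0

/-- the cover of `ker G`. -/
def Umap : (Fin (2 * p - 1) → Amod k p) →ₗ[Amod k p] (Fin p → Amod k p) :=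
  (Umat k p).mulVecLin

lemma Umap_stdV (j : Fin (2 * p - 1)) (i : Fin p) :
    Umap k p (stdV k p _ j) i = Umat k p i j := by
  simp [Umap, stdV, Matrix.mulVecLin_apply]

lemma Umap_smul_stdV (c : Amod k p) (j : Fin (2 * p - 1)) (i : Fin p) :
    Umap k p (c • stdV k p _ j) i = c * Umat k p i j := by
  rw [map_smul, Pi.smul_apply, Umap_stdV, smul_eq_mul]

lemma G_U (f : Fin (2 * p - 1) → Amod k p) : Gmap k p (Umap k p f) = 0 := by
  have : Gmap k p ∘ₗ Umap k p = 0 := by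
    apply (Pi.basisFun (Amod k p) _).ext
    intro j
    rw [Pi.basisFun_apply, LinearMap.comp_apply]
    ext i
    rw [Gmap_apply]
    have h := Umap_stdV k p j
    unfold stdV at h
    rw [h, h]
    simp only [Umat, LinearMap.zero_apply, Pi.zero_apply]
    have hi := i.2
    have hj := j.2
    split_ifs with h1 h2 h2
    · rw [mul_left_comm, ← pow_succ', ← mul_assoc, ← pow_succ', sub_eq_zero]
      congr 2 <;> omega
    · rw [mul_left_comm, ← pow_succ', y_pow_ge k p (by omega)]; simp
    · rw [← mul_assoc, ← pow_succ', x_pow_ge k p (by omega)]; simp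
    · simp
  exact LinearMap.congr_fun this f

lemma U_N (hp : 2 ≤ p) : NSub k p (2 * p - 1) p ≤ LinearMap.ker (Umap k p) := by
  apply NSub_le
  · intro j hj
    rw [LinearMap.mem_ker]
    ext i
    rw [Umap_smul_stdV, Umat]
    split_ifs with h
    · rw [← mul_assoc, ← pow_succ', x_pow_ge k p (by omega)]; simp
    · simp
  · intro j hj
    rw [LinearMap.mem_ker]
    ext i
    rw [Umap_smul_stdV, Umat]
    split_ifs with h
    · rw [mul_left_comm, ← pow_succ', y_pow_ge k p (by omega)]; simp
    · simp
  · intro j _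
    rw [x_pow, vzero_smul]
    exact Submodule.zero_mem _
  · intro j j' hj
    rw [LinearMap.mem_ker, map_sub]
    ext i
    rw [Pi.sub_apply, Umap_smul_stdV, Umap_smul_stdV, Umat, Umat]
    have hi := i.2
    have hj' := j'.2
    split_ifs with h1 h2 h2
    · rw [mul_left_comm, ← pow_succ', ← mul_assoc, ← pow_succ', Pi.zero_apply, sub_eq_zero]
      congr 2 <;> omega
    · rw [mul_left_comm, ← pow_succ', y_pow_ge k p (by omega)]; simp
    · rw [← mul_assoc, ← pow_succ', x_pow_ge k p (by omega)]; simp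
    · simp

/-- the component used to read off the coefficient of `x^e v_j`. -/
def i0 (e j : ℕ) : ℕ := min (j - e) (p - 1)

lemma i0_lt (hp : 2 ≤ p) (e j : ℕ) : i0 p e j < p := by
  unfold i0; omega

/-- the coefficient of `x^e v_j`. -/
def lam (hp : 2 ≤ p) (e j : ℕ) : (Fin p → Amod k p) →ₗ[k] k :=
  coef k p (i0 p e j + (p - 1) + e - j) (j - i0 p e j) ∘ₗ
    LinearMap.proj (⟨i0 p e j, i0_lt p hp e j⟩ : Fin p)

lemma lam_apply (hp : 2 ≤ p) (e j : ℕ) (a : Fin p → Amod k p) :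
    lam k p hp e j a = coef k p (i0 p e j + (p - 1) + e - j) (j - i0 p e j)
      (a ⟨i0 p e j, i0_lt p hp e j⟩) := rfl

/-- the `k`-linear section. -/
def Smap (hp : 2 ≤ p) : (Fin p → Amod k p) →ₗ[k] (Fin (2 * p - 1) → Amod k p) :=
  LinearMap.pi fun j => ∑ e ∈ range p,
    if e ≤ j.val then LinearMap.toSpanSingleton k (Amod k p) (xA k p ^ e) ∘ₗ lam k p hp e j.val
    else 0

lemma Smap_apply (hp : 2 ≤ p) (a : Fin p → Amod k p) (j : Fin (2 * p - 1)) :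
    Smap k p hp a j = ∑ e ∈ range p,
      if e ≤ j.val then lam k p hp e j.val a • xA k p ^ e else 0 := by
  rw [Smap, LinearMap.pi_apply, LinearMap.sum_apply]
  apply Finset.sum_congr rfl
  intro e _
  split_ifs <;> rfl

lemma coef_S (hp : 2 ≤ p) (a : Fin p → Amod k p) (j : Fin (2 * p - 1)) (e : ℕ) (he : e < p)
    (hej : e ≤ j.val) : coef k p e 0 (Smap k p hp a j) = lam k p hp e j.val a := by
  rw [Smap_apply, map_sum, Finset.sum_eq_single e]
  · rw [if_pos hej, map_smul]
    have := coef_monom k p e 0 e 0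
    rw [pow_zero, mul_one] at this
    rw [this, if_pos (by omega), smul_eq_mul, mul_one]
  · intro e' _ hne
    split_ifs
    · have := coef_monom k p e' 0 e 0
      rw [pow_zero, mul_one] at this
      rw [map_smul, this, if_neg (by omega), smul_zero]
    · rw [map_zero]
  · intro h
    simp at h
    omega

lemma lam_U (hp : 2 ≤ p) (e j e' : ℕ) (hj : j < 2 * p - 1) (he : e < p) (hej : e ≤ j)
    (j' : ℕ) (hj' : j' < 2 * p - 1) (he' : e' < p) (hej' : e' ≤ j') :
    lam k p hp e' j' (Umap k p (xA k p ^ e • stdV k p _ ⟨j, hj⟩))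
      = if e' = e ∧ j' = j then 1 else 0 := by
  rw [lam_apply, Umap_smul_stdV, Umat]
  simp only
  have hi : i0 p e' j' = min (j' - e') (p - 1) := rfl
  generalize i0 p e' j' = i at *
  split_ifs with h1 h2 h2
  · rw [← mul_assoc, ← pow_add, coef_monom, if_pos (by omega)]
  · rw [← mul_assoc, ← pow_add, coef_monom, if_neg (by omega)]
  · omega
  · rw [mul_zero, map_zero]

lemma S_U_basis (hp : 2 ≤ p) (e j : ℕ) (hj : j < 2 * p - 1) (he : e < p) (hej : e ≤ j) :
    Smap k p hp (Umap k p (xA k p ^ e • stdV k p _ ⟨j, hj⟩)) =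
      xA k p ^ e • stdV k p _ ⟨j, hj⟩ := by
  ext j'
  rw [Smap_apply]
  have : ∀ e' ∈ range p, (if e' ≤ j'.val then
      lam k p hp e' j'.val (Umap k p (xA k p ^ e • stdV k p _ ⟨j, hj⟩)) • xA k p ^ e' else 0)
      = if e' = e then (if j'.val = j then xA k p ^ e else 0) else 0 := by
    intro e' he'
    rw [Finset.mem_range] at he'
    by_cases h : e' ≤ j'.val
    · rw [if_pos h, lam_U k p hp e j e' hj he hej j'.val j'.2 he' h]
      by_cases h1 : e' = e
      · subst h1
        by_cases h2 : j'.val = j <;> simp [h2]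
      · simp [h1]
    · rw [if_neg h]
      split_ifs
      · omega
      · rfl
      · rfl
  rw [Finset.sum_congr rfl this, Finset.sum_ite_eq', if_pos (by simpa using he)]
  simp only [stdV, Pi.smul_apply, Pi.single_apply, Fin.ext_iff, smul_eq_mul]
  split_ifs <;> simp

/-- `k`-submodule of vectors on which `S ∘ U` is the identity modulo relations. -/
def goodSub (hp : 2 ≤ p) : Submodule k (Fin (2 * p - 1) → Amod k p) :=
  ((NSub k p (2 * p - 1) p).restrictScalars k).comap
    (Smap k p hp ∘ₗ (Umap k p).restrictScalars k - LinearMap.id)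

lemma mem_good (hp : 2 ≤ p) (f : Fin (2 * p - 1) → Amod k p) :
    f ∈ goodSub k p hp ↔ Smap k p hp (Umap k p f) - f ∈ NSub k p (2 * p - 1) p := Iff.rfl

lemma good_of_N (hp : 2 ≤ p) (f : Fin (2 * p - 1) → Amod k p)
    (hf : f ∈ NSub k p (2 * p - 1) p) : f ∈ goodSub k p hp := by
  rw [mem_good, LinearMap.mem_ker.mp (U_N k p hp hf), map_zero, zero_sub]
  exact Submodule.neg_mem _ hf

lemma good_monom (hp : 2 ≤ p) (t : ℕ) : ∀ (s j : ℕ) (hj : j < 2 * p - 1),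
    (xA k p ^ s * yA k p ^ t) • stdV k p _ ⟨j, hj⟩ ∈ goodSub k p hp := by
  induction t with
  | zero =>
    intro s j hj
    rw [pow_zero, mul_one]
    by_cases h1 : p ≤ s
    · rw [x_pow_ge k p h1, vzero_smul]
      exact Submodule.zero_mem _
    by_cases h2 : j < s
    · apply good_of_N
      exact x_pow_mem k p _ (rel_first k p) (rel_step k p) j hj s h2
    rw [mem_good, S_U_basis k p hp s j hj (by omega) (by omega), sub_self]
    exact Submodule.zero_mem _
  | succ t ih =>
    intro s j hj
    by_cases h : j = 2 * p - 1 - 1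
    · apply good_of_N
      rw [pow_succ, ← mul_assoc, vmul_smul]
      exact Submodule.smul_mem _ _ (rel_last k p _ h)
    · have h1 := ih (s + 1) (j + 1) (by omega)
      have h2 := good_of_N k p hp _ (Submodule.smul_mem _ (xA k p ^ s * yA k p ^ t)
        (rel_step k p (d := p) (⟨j, hj⟩ : Fin (2 * p - 1)) ⟨j + 1, by omega⟩ rfl))
      have h3 := Submodule.add_mem _ h2 h1
      convert h3 using 1
      rw [smul_sub, smul_smul, smul_smul]
      rw [show xA k p ^ (s + 1) * yA k p ^ t = xA k p ^ s * yA k p ^ t * xA k p by ring,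
        sub_add_cancel, pow_succ, mul_assoc]

lemma good_top (hp : 2 ≤ p) (f : Fin (2 * p - 1) → Amod k p) : f ∈ goodSub k p hp := by
  have h1 : ∀ (c : Amod k p) (j : Fin (2 * p - 1)), c • stdV k p _ j ∈ goodSub k p hp := by
    intro c j
    have hc : c ∈ Submodule.span k
      (Set.range fun q : ℕ × ℕ => xA k p ^ q.1 * yA k p ^ q.2) := by
      rw [span_monom]; trivial
    induction hc using Submodule.span_induction with
    | mem c hc =>
      obtain ⟨q, rfl⟩ := hc
      exact good_monom k p hp q.2 q.1 j.val j.2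
    | zero => rw [vzero_smul]; exact Submodule.zero_mem _
    | add a b _ _ ha hb => rw [add_smul]; exact Submodule.add_mem _ ha hb
    | smul r a _ ha => rw [smul_assoc]; exact Submodule.smul_mem _ _ ha
  have h2 : f = ∑ j, f j • stdV k p _ j := by
    exact vsum k p f
  rw [h2]
  exact Submodule.sum_mem _ fun j _ => h1 _ j

lemma ker_U (hp : 2 ≤ p) : LinearMap.ker (Umap k p) = NSub k p (2 * p - 1) p := by
  apply le_antisymm _ (U_N k p hp)
  intro f hf
  have h := (mem_good k p hp f).mp (good_top k p hp f)
  rw [LinearMap.mem_ker.mp hf, map_zero, zero_sub] at h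
  exact (Submodule.neg_mem_iff _).mp h

lemma S_U_S (hp : 2 ≤ p) (a : Fin p → Amod k p) :
    Smap k p hp (Umap k p (Smap k p hp a)) = Smap k p hp a := by
  let Q : Submodule k (Fin (2 * p - 1) → Amod k p) :=
    LinearMap.eqLocus (Smap k p hp ∘ₗ (Umap k p).restrictScalars k) LinearMap.id
  suffices Smap k p hp a ∈ Q from this
  have h2 : Smap k p hp a = ∑ j, Smap k p hp a j • stdV k p _ j := by
    conv_lhs => rw [← (Pi.basisFun (Amod k p) (Fin (2 * p - 1))).sum_repr (Smap k p hp a)]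
    simp [stdV]
  rw [h2]
  refine Submodule.sum_mem _ fun j _ => ?_
  rw [Smap_apply, Finset.sum_smul]
  refine Submodule.sum_mem _ fun e he => ?_
  rw [Finset.mem_range] at he
  split_ifs with h
  · rw [smul_assoc]
    exact Submodule.smul_mem _ _ (S_U_basis k p hp e j.val j.2 he h)
  · rw [vzero_smul]
    exact Submodule.zero_mem _

lemma ker_S_zero (hp : 2 ≤ p) (a : Fin p → Amod k p) (ha : Gmap k p a = 0)
    (hS : Smap k p hp a = 0) : a = 0 := by
  funext i
  apply coef_ext
  intro s t hs ht
  by_cases hst : s + t < p - 1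
  · exact ker_vanish k p ha i.val s t i.2 hst
  have hi := i.2
  have h1 := coef_S k p hp a ⟨i.val + t, by omega⟩ (s + t - (p - 1)) (by omega)
    (by simp only; omega)
  rw [hS, Pi.zero_apply, map_zero, lam_apply] at h1
  obtain ⟨δ, hδ⟩ : ∃ δ, i0 p (s + t - (p - 1)) (i.val + t) = i.val + δ :=
    ⟨i0 p (s + t - (p - 1)) (i.val + t) - i.val, by unfold i0; omega⟩
  have hδ2 : i.val + δ < p ∧ s + δ < p ∧ δ ≤ t := by
    unfold i0 at hδ; omega
  have h2 := ker_chain k p ha δ i.val s (t - δ) (by omega) (by omega) (by omega)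
  rw [show t - δ + δ = t by omega] at h2
  rw [show a i = a ⟨i.val, by omega⟩ from rfl, h2, h1]
  simp only [hδ]
  congr 1
  congr 1 <;> omega

lemma range_U (hp : 2 ≤ p) : LinearMap.range (Umap k p) = LinearMap.ker (Gmap k p) := by
  apply le_antisymm
  · rintro _ ⟨f, rfl⟩
    exact G_U k p f
  · intro a ha
    refine ⟨Smap k p hp a, ?_⟩
    rw [← sub_eq_zero]
    apply ker_S_zero k p hp
    · rw [map_sub, G_U, LinearMap.mem_ker.mp ha, sub_zero]
    · rw [map_sub, S_U_S, sub_self]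

lemma ker_G_le (hp : 2 ≤ p) : LinearMap.ker (Gmap k p) ≤
    mA k p • (⊤ : Submodule (Amod k p) (Fin p → Amod k p)) := by
  intro a ha
  have h : a = ∑ i, a i • (Pi.single i 1 : Fin p → Amod k p) := by
    conv_lhs => rw [← (Pi.basisFun (Amod k p) (Fin p)).sum_repr a]
    simp
  rw [h]
  refine Submodule.sum_mem _ fun i _ => smul_mem_m k p ?_ _
  rw [← range_U k p hp] at ha
  obtain ⟨f, rfl⟩ := ha
  rw [Umap, Matrix.mulVecLin_apply]
  change ∑ j, Umat k p i j * f j ∈ mA k p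
  refine Ideal.sum_mem (mA k p) fun j _ => Ideal.mul_mem_right _ (mA k p) ?_
  rw [Umat]
  split_ifs with h
  · by_cases h1 : i.val + (p - 1) - j.val = 0
    · exact Ideal.mul_mem_left _ _ (Ideal.pow_mem_of_mem _ (y_mem k p) _ (by omega))
    · exact Ideal.mul_mem_right _ _ (Ideal.pow_mem_of_mem _ (x_mem k p) _ (by omega))
  · exact Ideal.zero_mem _

lemma W_iso (hp : 2 ≤ p) :
    Nonempty (LinearMap.ker (Gmap k p) ≃ₗ[Amod k p] Wmod k p (2 * p - 1) p) :=
  ⟨((Submodule.quotEquivOfEq _ _ (ker_U k p hp).symm).trans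
    ((Umap k p).quotKerEquivRange.trans (LinearEquiv.ofEq _ _ (range_U k p hp)))).symm⟩

end Aux

/-- every minimal second syzygy of `W_{p−1,p−1}` is isomorphic to
`W_{2p−1,p}` as an `A`-module. -/
theorem minSecondSyz_W_pminus1_iso
    [IsAlgClosed k] [Fact p.Prime] [CharP k p]
    (N : Type) [AddCommGroup N] [Module (Amod k p) N]
    (hN : IsMinSyz k p 2 (ModuleCat.of (Amod k p) N)
      (ModuleCat.of (Amod k p) (Wmod k p (p - 1) (p - 1)))) :
    Nonempty (N ≃ₗ[Amod k p] Wmod k p (2 * p - 1) p) := by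
  have hp : 2 ≤ p := (Fact.out : p.Prime).two_le
  obtain ⟨r, g, hg, hk, r', g', hg', hk', ⟨ψ⟩⟩ := hN
  obtain ⟨φ⟩ := cover_unique k p (LinearEquiv.refl _ (Wmod k p (p - 1) (p - 1))) g hg hk
    (NSub k p (p - 1) (p - 1)).mkQ (Submodule.mkQ_surjective _)
    (by rw [Submodule.ker_mkQ]; exact NSub_le_m k p (by omega))
  obtain ⟨θ⟩ := cover_unique k p
    (φ.trans (LinearEquiv.ofEq _ _ ((Submodule.ker_mkQ _).trans (Gmap_range k p hp).symm)))
    g' hg' hk' (Gmap k p).rangeRestrict (LinearMap.surjective_rangeRestrict _)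
    (by rw [LinearMap.ker_rangeRestrict]; exact ker_G_le k p hp)
  obtain ⟨ω⟩ := W_iso k p hp
  exact ⟨ψ.trans (θ.trans ((LinearEquiv.ofEq _ _ (LinearMap.ker_rangeRestrict _)).trans ω))⟩

end
end

section
/- Let p ≥ 3 and n ≥ p. Then no minimal second syzygy of W_{n,p−1} has the equal images property. -/
open MvPolynomial Module

set_option maxHeartbeats 1000000
set_option synthInstance.maxHeartbeats 400000

noncomputable section

variable (k : Type) [Field k] (p : ℕ)

section helpers

variable {k p}

/-- exponent vector of `X^a Y^b` -/
def expo (a b : ℕ) : Fin 2 →₀ ℕ := Finsupp.single 0 a + Finsupp.single 1 b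

lemma coeff_relI (a b : ℕ) (ha : a < p) (hb : b < p) (q : MvPolynomial (Fin 2) k)
    (hq : q ∈ relI k p) : coeff (expo a b) q = 0 := by
  obtain ⟨s, t, rfl⟩ := Ideal.mem_span_pair.1 hq
  rw [coeff_add, X_pow_eq_monomial, X_pow_eq_monomial, coeff_mul_monomial', coeff_mul_monomial',
    if_neg, if_neg, add_zero]
  · intro h
    have := h 1
    simp [expo] at this
    omega
  · intro h
    have := h 0
    simp [expo] at this
    omega

lemma relI_le_ker (a b : ℕ) (ha : a < p) (hb : b < p) :
    (relI k p).restrictScalars k ≤ LinearMap.ker (lcoeff k (expo a b)) := by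
  intro q hq
  exact coeff_relI a b ha hb q hq

/-- coefficient functional on `A`, in the range where it is well defined -/
def coAux (a b : ℕ) (ha : a < p) (hb : b < p) : Amod k p →ₗ[k] k :=
  ((relI k p).restrictScalars k).liftQ (lcoeff k (expo a b)) (relI_le_ker a b ha hb)

/-- coefficient functional on `A` -/
def co (a b : ℕ) : Amod k p →ₗ[k] k :=
  if h : a < p ∧ b < p then coAux a b h.1 h.2 else 0

lemma co_mk (a b : ℕ) (ha : a < p) (hb : b < p) (q : MvPolynomial (Fin 2) k) :
    co a b (Ideal.Quotient.mk (relI k p) q) = coeff (expo a b) q := by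
  unfold co
  rw [dif_pos ⟨ha, hb⟩]
  rfl

lemma co_x_succ (a b : ℕ) (ha : a + 1 < p) (hb : b < p) (f : Amod k p) :
    co (a + 1) b (xA k p * f) = co a b f := by
  obtain ⟨q, rfl⟩ := Ideal.Quotient.mk_surjective f
  rw [xA, ← map_mul, co_mk _ _ ha hb, co_mk _ _ (by omega) hb]
  have : expo (a + 1) b = Finsupp.single 0 1 + expo a b := by
    unfold expo
    rw [Finsupp.single_add]; abel
  rw [this, coeff_X_mul]

lemma co_y_succ (a b : ℕ) (ha : a < p) (hb : b + 1 < p) (f : Amod k p) :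
    co a (b + 1) (yA k p * f) = co a b f := by
  obtain ⟨q, rfl⟩ := Ideal.Quotient.mk_surjective f
  rw [yA, ← map_mul, co_mk _ _ ha hb, co_mk _ _ ha (by omega)]
  have : expo a (b + 1) = Finsupp.single 1 1 + expo a b := by
    unfold expo
    rw [Finsupp.single_add]; abel
  rw [this, coeff_X_mul]

lemma co_x_zero (b : ℕ) (f : Amod k p) : co 0 b (xA k p * f) = 0 := by
  by_cases h : 0 < p ∧ b < p
  · obtain ⟨q, rfl⟩ := Ideal.Quotient.mk_surjective f
    rw [xA, ← map_mul, co_mk _ _ h.1 h.2, coeff_X_mul', if_neg]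
    simp [expo]
  · unfold co
    rw [dif_neg h]; rfl

lemma co_y_zero (a : ℕ) (f : Amod k p) : co a 0 (yA k p * f) = 0 := by
  by_cases h : a < p ∧ 0 < p
  · obtain ⟨q, rfl⟩ := Ideal.Quotient.mk_surjective f
    rw [yA, ← map_mul, co_mk _ _ h.1 h.2, coeff_X_mul', if_neg]
    simp [expo]
  · unfold co
    rw [dif_neg h]; rfl

lemma co_x_pow (m b : ℕ) (hm : m < p) (hb : b < p) (f : Amod k p) :
    co m b (xA k p ^ m * f) = co 0 b f := by
  induction m with
  | zero => simp
  | succ m ih => rw [pow_succ', mul_assoc, co_x_succ _ _ hm hb, ih (by omega)]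

lemma co_x_pow_lt (m a b : ℕ) (ha : a < m) (hb : b < p) (f : Amod k p) :
    co a b (xA k p ^ m * f) = 0 := by
  by_cases hp : a < p
  · obtain ⟨c, rfl⟩ : ∃ c, m = a + (c + 1) := ⟨m - a - 1, by omega⟩
    rw [pow_add, mul_assoc, co_x_pow _ _ hp hb, pow_succ', mul_assoc, co_x_zero]
  · unfold co
    rw [dif_neg (by tauto)]; rfl

lemma xA_pow_p : xA k p ^ p = 0 := by
  rw [xA, ← map_pow]
  exact Ideal.Quotient.eq_zero_iff_mem.2 (Ideal.subset_span (by simp))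

lemma mem_mA_of_co (hp : 0 < p) (f : Amod k p) (hf : co 0 0 f = 0) : f ∈ mA k p := by
  obtain ⟨q, rfl⟩ := Ideal.Quotient.mk_surjective f
  rw [co_mk _ _ hp hp] at hf
  have e0 : expo 0 0 = 0 := by simp [expo]
  rw [e0] at hf
  have key : ∀ q : MvPolynomial (Fin 2) k,
      Ideal.Quotient.mk (relI k p) (q - C (coeff 0 q)) ∈ mA k p := by
    intro q
    induction q using MvPolynomial.induction_on with
    | C a => simp
    | add q r hq hr =>
      have := (mA k p).add_mem hq hr
      rw [← map_add] at this
      convert this using 2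
      rw [coeff_add, C_add]; ring
    | mul_X q i hq =>
      have h0 : coeff 0 (q * X i) = 0 := by
        rw [coeff_mul_X', if_neg]; simp
      rw [h0, C_0, sub_zero, map_mul]
      apply Ideal.mul_mem_left
      apply Ideal.subset_span
      fin_cases i
      · left; rfl
      · right; rfl
  have := key q
  rwa [hf, C_0, sub_zero] at this

/-- the coordinate functionals -/
def cc (n i : ℕ) : Amod k p →ₗ[k] k :=
  if n ≤ i + p then co (i + p - n) (n - 1 - i) else 0

/-- submodule of `A^n` on which all translates of the functional vanish -/
def KK (n : ℕ) : Submodule (Amod k p) (Fin n → Amod k p) where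
  carrier := {v | ∀ s : Amod k p, ∑ i : Fin n, cc n i.val (s * v i) = 0}
  add_mem' := by
    intro v w hv hw s
    simp only [Pi.add_apply, mul_add, map_add, Finset.sum_add_distrib, hv s, hw s, add_zero]
  zero_mem' := by intro s; simp
  smul_mem' := by
    intro c v hv s
    have := hv (s * c)
    simpa only [Pi.smul_apply, smul_eq_mul, mul_assoc] using this

lemma sum_std (n : ℕ) (i : Fin n) (s a : Amod k p) :
    ∑ j : Fin n, cc n j.val (s * (a • stdV k p n i) j) = cc n i.val (a * s) := by
  rw [Finset.sum_eq_single i]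
  · simp [stdV, mul_comm]
  · intro j _ hj
    simp [stdV, hj]
  · simp

lemma NSet_smul (hp3 : 3 ≤ p) (n : ℕ) (hn : p ≤ n) (w : Fin n → Amod k p)
    (hw : w ∈ NSet k p n (p - 1)) : xA k p • w ∈ KK n ∧ yA k p • w ∈ (KK n : Submodule (Amod k p) (Fin n → Amod k p)) := by
  unfold NSet at hw
  simp only [Set.mem_union, Set.mem_iUnion, Set.mem_singleton_iff, exists_prop] at hw
  rcases hw with ((⟨i, hi, rfl⟩ | ⟨i, hi, rfl⟩) | ⟨i, hi, rfl⟩) | ⟨i, j, hij, rfl⟩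
  · suffices h : xA k p • stdV k p n i ∈ KK n from
      ⟨Submodule.smul_mem _ _ h, Submodule.smul_mem _ _ h⟩
    intro s
    rw [sum_std, cc, hi]
    split_ifs with h
    · rw [show 0 + p - n = 0 by omega, co_x_zero]
    · rfl
  · suffices h : yA k p • stdV k p n i ∈ KK n from
      ⟨Submodule.smul_mem _ _ h, Submodule.smul_mem _ _ h⟩
    intro s
    rw [sum_std, cc, hi]
    split_ifs with h
    · rw [show n - 1 - (n - 1) = 0 by omega, co_y_zero]
    · rfl
  · constructor
    · rw [smul_smul, ← pow_succ', show p - 1 + 1 = p by omega, xA_pow_p]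
      exact (zero_smul (Amod k p) (stdV k p n i)).symm ▸ Submodule.zero_mem _
    · rw [smul_smul]
      intro s
      rw [sum_std, cc]
      split_ifs with h
      · have hi2 := i.2
        rcases Nat.lt_or_ge i.val (n - 1) with h1 | h1
        · rw [show yA k p * xA k p ^ (p - 1) * s = xA k p ^ (p - 1) * (yA k p * s) by ring]
          exact co_x_pow_lt _ _ _ (by omega) (by omega) _
        · rw [show n - 1 - i.val = 0 by omega, mul_assoc, co_y_zero]
      · rfl
  · suffices h : yA k p • stdV k p n i - xA k p • stdV k p n j ∈ KK n from
      ⟨Submodule.smul_mem _ _ h, Submodule.smul_mem _ _ h⟩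
    intro s
    simp only [Pi.sub_apply, mul_sub, map_sub, Finset.sum_sub_distrib]
    rw [sum_std, sum_std, sub_eq_zero, cc, cc, hij]
    have hj2 := j.2
    by_cases h : n ≤ i.val + p
    · rw [if_pos h, if_pos (by omega)]
      rw [show n - 1 - i.val = (n - 1 - (i.val + 1)) + 1 by omega,
        co_y_succ _ _ (by omega) (by omega),
        show i.val + 1 + p - n = (i.val + p - n) + 1 by omega,
        co_x_succ _ _ (by omega) (by omega)]
    · rw [if_neg h]
      split_ifs with h'
      · rw [show i.val + 1 + p - n = 0 by omega, co_x_zero]; rfl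
      · rfl

lemma mNSub_le (hp3 : 3 ≤ p) (n : ℕ) (hn : p ≤ n) :
    mA k p • NSub k p n (p - 1) ≤ KK n := by
  unfold mA NSub
  rw [Submodule.span_smul_span, Submodule.span_le]
  rintro _ ⟨a, ha, w, hw, rfl⟩
  have := NSet_smul hp3 n hn w hw
  rcases ha with rfl | rfl
  · exact this.1
  · exact this.2

lemma not_mem_mNSub (hp3 : 3 ≤ p) (n : ℕ) (hn : p ≤ n) (i : Fin n) (hi : i.val = n - 1) :
    xA k p ^ (p - 1) • stdV k p n i ∉ mA k p • NSub k p n (p - 1) := by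
  intro h
  have := mNSub_le hp3 n hn h 1
  rw [sum_std, cc, hi, if_pos (by omega), show n - 1 + p - n = p - 1 by omega,
    show n - 1 - (n - 1) = 0 by omega, co_x_pow _ _ (by omega) (by omega)] at this
  rw [← map_one (Ideal.Quotient.mk (relI k p)), co_mk _ _ (by omega) (by omega)] at this
  simp [expo] at this

lemma x_mem_NSub (hp3 : 3 ≤ p) (n : ℕ) (hn : p ≤ n) (i : Fin n) (hi : i.val = n - 1) :
    xA k p ^ (p - 1) • stdV k p n i ∈ NSub k p n (p - 1) := by
  apply Submodule.subset_span
  left; right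
  simp only [Set.mem_iUnion, Set.mem_singleton_iff, exists_prop]
  exact ⟨i, by omega, rfl⟩

lemma main_aux (hp3 : 3 ≤ p) (n : ℕ) (hn : p ≤ n)
    (N : Type) [AddCommGroup N] [Module (Amod k p) N]
    (r : ℕ) (g : (Fin r → Amod k p) →ₗ[Amod k p] Wmod k p n (p - 1))
    (hg : Function.Surjective g)
    (r' : ℕ) (g' : (Fin r' → Amod k p) →ₗ[Amod k p] (LinearMap.ker g))
    (hg' : Function.Surjective g')
    (e : N ≃ₗ[Amod k p] (LinearMap.ker g')) : ¬ EIP k p N := by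
  intro hE
  let i : Fin n := ⟨n - 1, by omega⟩
  have hx := x_mem_NSub (k := k) hp3 n hn i rfl
  have hx' := not_mem_mNSub (k := k) hp3 n hn i rfl
  -- the comparison map back to the standard presentation
  obtain ⟨ψ, hψ⟩ := Module.projective_lifting_property (NSub k p n (p - 1)).mkQ g
    (Submodule.mkQ_surjective _)
  obtain ⟨a, ha⟩ := hg ((NSub k p n (p - 1)).mkQ (stdV k p n i))
  have hψg : ∀ v, (NSub k p n (p - 1)).mkQ (ψ v) = g v := fun v => LinearMap.congr_fun hψ v
  have hz : g (xA k p ^ (p - 1) • a) = 0 := by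
    rw [map_smul, ha, ← map_smul]
    exact (Submodule.Quotient.mk_eq_zero _).2 hx
  let z : LinearMap.ker g := ⟨xA k p ^ (p - 1) • a, hz⟩
  have hxz : xA k p • z = 0 := by
    apply Subtype.ext
    change xA k p • (xA k p ^ (p - 1) • a) = 0
    rw [smul_smul, ← pow_succ', show p - 1 + 1 = p by omega, xA_pow_p]
    exact zero_smul (Amod k p) a
  have hxm : xA k p ∈ mA k p := Ideal.subset_span (by simp)
  have hzm : z ∉ mA k p • (⊤ : Submodule (Amod k p) (LinearMap.ker g)) := by
    intro h
    have hle : (mA k p • (⊤ : Submodule (Amod k p) (LinearMap.ker g))).map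
        (ψ ∘ₗ (LinearMap.ker g).subtype) ≤ mA k p • NSub k p n (p - 1) := by
      rw [Submodule.map_smul'']
      refine Submodule.smul_mono le_rfl ?_
      rintro _ ⟨w, -, rfl⟩
      apply (Submodule.Quotient.mk_eq_zero _).1
      exact (hψg w).trans w.2
    have h1 : ψ (xA k p ^ (p - 1) • a) ∈ mA k p • NSub k p n (p - 1) :=
      hle ⟨z, h, rfl⟩
    have h2 : ψ a - stdV k p n i ∈ NSub k p n (p - 1) := by
      rw [← Submodule.Quotient.mk_eq_zero]
      change (NSub k p n (p - 1)).mkQ (ψ a - stdV k p n i) = 0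
      rw [map_sub, hψg, ha, sub_self]
    have h3 : xA k p ^ (p - 1) • (ψ a - stdV k p n i) ∈ mA k p • NSub k p n (p - 1) :=
      Submodule.smul_mem_smul (Ideal.pow_mem_of_mem _ hxm _ (by omega)) h2
    apply hx'
    have h4 := Submodule.sub_mem _ h1 h3
    rwa [map_smul, smul_sub, sub_sub_cancel] at h4
  obtain ⟨f, hf⟩ := hg' z
  have hxf : g' (xA k p • f) = 0 := by rw [map_smul, hf, hxz]
  -- all coordinates of `f` lie in the maximal ideal
  have hcoord : ∀ j, f j ∈ mA k p := by
    intro j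
    apply mem_mA_of_co (by omega)
    let n0 : N := e.symm ⟨xA k p • f, hxf⟩
    have hy : IsPointOp k p (yA k p) := ⟨0, 1, by simp, by simp⟩
    have hm : xA k p • n0 ∈ mA k p • (⊤ : Submodule (Amod k p) N) :=
      Submodule.smul_mem_smul hxm trivial
    rw [← hE _ hy] at hm
    obtain ⟨n1, hn1⟩ := hm
    have h1 : yA k p • n1 = xA k p • n0 := hn1
    have h2 := congrArg e h1
    rw [map_smul, map_smul, e.apply_symm_apply] at h2
    have h3 : yA k p * (e n1).1 j = xA k p * (xA k p * f j) :=
      congrFun (congrArg Subtype.val h2) j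
    have h4 := congrArg (co 2 0) h3
    rw [co_y_zero, co_x_succ _ _ (by omega) (by omega), co_x_succ _ _ (by omega) (by omega)] at h4
    exact h4.symm
  apply hzm
  rw [← hf]
  have hfs : f = ∑ j, f j • (Pi.single j 1 : Fin r' → Amod k p) := by
    ext j
    simp [Finset.sum_apply, Pi.single_apply]
  rw [hfs, map_sum]
  apply Submodule.sum_mem
  intro j _
  rw [map_smul]
  exact Submodule.smul_mem_smul (hcoord j) trivial

end helpers

/-- for `p ≥ 3` and `n ≥ p`, no minimal second syzygy of `W_{n,p−1}` has the
equal images property. -/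
theorem minSecondSyz_W_pminus1_not_EIP
    [IsAlgClosed k] [Fact p.Prime] [CharP k p] (hp3 : 3 ≤ p)
    (n : ℕ) (hn : p ≤ n)
    (N : Type) [AddCommGroup N] [Module (Amod k p) N]
    (hN : IsMinSyz k p 2 (ModuleCat.of (Amod k p) N)
      (ModuleCat.of (Amod k p) (Wmod k p n (p - 1)))) :
    ¬ EIP k p N := by
  obtain ⟨r, g, hg, -, r', g', hg', -, ⟨e⟩⟩ := hN
  exact main_aux hp3 n hn N r g hg r' g' hg' e

end
end
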